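/- For every integer k ≥ 3 there exists a constant c > 0 such that for all sufficiently large n with nk even, there exists a k-regular simple graph G on n vertices whose algebraic connectivity satisfies λ2(L(G)) ≥ c. (This is the deterministic existence consequence of the fact that almost every k-regular random graph has algebraic connectivity bounded below by a positive constant c_k as n → ∞.) -/

import Mathlib

open Matrix

open Classical in
/-- The Laplacian matrix of a simple graph: `L i i` is the degree of vertex `i`,
`L i j = -1` if `i` and `j` are adjacent, and `L i j = 0` otherwise. -/
noncomputable def lap {V : Type*} [Fintype V] (G : SimpleGraph V) : Matrix V V ℝ :=
  Matrix.of fun i j =>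
    if i = j then ({k | G.Adj i k}.ncard : ℝ) else if G.Adj i j then -1 else 0

/-- The algebraic connectivity `λ₂` : the second smallest eigenvalue of the Laplacian
(for at least 2 vertices), characterized as the minimum of `xᵀ L x` over real vectors
`x` with `∑ i, x i = 0` and `‖x‖ = 1`. -/
noncomputable def lambda2 {V : Type*} [Fintype V] (A : Matrix V V ℝ) : ℝ :=
  sInf {r : ℝ | ∃ x : V → ℝ, (∑ i, x i) = 0 ∧ (∑ i, (x i) ^ 2) = 1 ∧
    r = x ⬝ᵥ A.mulVec x}

open Finset

/-- coarea -/
lemma coarea {V E : Type*} [Fintype V] [DecidableEq V] [Fintype E] (s t : E → V) (ε : ℝ)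
    (hexp : ∀ A : Finset V, 2 * A.card ≤ Fintype.card V →
      ε * A.card ≤ ((univ.filter fun e => ¬ (s e ∈ A ↔ t e ∈ A)).card : ℝ))
    (N : ℕ) : ∀ h : V → ℝ, (∀ v, 0 ≤ h v) → (univ.filter fun v => 0 < h v).card ≤ N →
      2 * (univ.filter fun v => 0 < h v).card ≤ Fintype.card V →
      ε * ∑ v, h v ≤ ∑ e, |h (s e) - h (t e)| := by
  induction N with
  | zero =>
    intro h h0 hc _
    have : ∀ v, h v = 0 := by
      intro v
      have h1 := Finset.card_eq_zero.mp (Nat.le_zero.mp hc)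
      have h2 : v ∉ (univ.filter fun v => 0 < h v) := by rw [h1]; simp
      simp at h2
      exact le_antisymm h2 (h0 v)
    simp [this]
  | succ N ih =>
    intro h h0 hc h2
    set S := univ.filter fun v => 0 < h v with hS
    have memS : ∀ v, v ∈ S ↔ 0 < h v := by intro v; simp [hS]
    by_cases hne : S.Nonempty
    swap
    · have : ∀ v, h v = 0 := by
        intro v
        have h2 : v ∉ S := by
          rw [Finset.not_nonempty_iff_eq_empty] at hne; rw [hne]; simp
        rw [memS] at h2
        exact le_antisymm (not_lt.mp h2) (h0 v)
      simp [this]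
    obtain ⟨v0, hv0, hmin⟩ := S.exists_min_image h hne
    set μ := h v0
    have hμ : 0 < μ := (memS v0).1 hv0
    set hp : V → ℝ := fun v => if v ∈ S then h v - μ else 0 with hhp
    have hp0 : ∀ v, 0 ≤ hp v := by
      intro v; simp only [hhp]; split_ifs with hv
      · linarith [hmin v hv]
      · exact le_rfl
    have hsub : (univ.filter fun v => 0 < hp v) ⊂ S := by
      rw [Finset.ssubset_iff_of_subset]
      · exact ⟨v0, hv0, by simp [hhp, hv0, μ]⟩
      · intro v hv
        by_contra hvS
        simp [hhp, hvS] at hv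
    have hcard := Finset.card_lt_card hsub
    have key := ih hp hp0 (by omega) (by omega)
    have hzero : ∀ v, v ∉ S → h v = 0 := fun v hv => by
      rw [memS] at hv; exact le_antisymm (not_lt.mp hv) (h0 v)
    have e1 : ∑ v, h v = ∑ v, hp v + μ * S.card := by
      have : ∀ v, h v = hp v + μ * (if v ∈ S then 1 else 0) := by
        intro v; simp only [hhp]; split_ifs with hv
        · ring
        · rw [hzero v hv]; ring
      rw [Finset.sum_congr rfl fun v _ => this v, Finset.sum_add_distrib, ← Finset.mul_sum]
      simp
    have e2 : ∑ e, |h (s e) - h (t e)| = ∑ e, |hp (s e) - hp (t e)| +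
        μ * ((univ.filter fun e => ¬ (s e ∈ S ↔ t e ∈ S)).card : ℝ) := by
      have : ∀ e, |h (s e) - h (t e)| = |hp (s e) - hp (t e)| +
          μ * (if ¬ (s e ∈ S ↔ t e ∈ S) then 1 else 0) := by
        intro e
        have a1 := hmin (s e)
        have a2 := hmin (t e)
        simp only [hhp]
        by_cases hs : s e ∈ S <;> by_cases ht : t e ∈ S
        · simp [hs, ht]
        · have := a1 hs
          simp [hs, ht, hzero _ ht]
          rw [abs_of_nonneg (h0 _), abs_of_nonneg (by linarith)]; ring
        · have := a2 ht
          simp [hs, ht, hzero _ hs]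
          rw [abs_of_nonneg (h0 _), abs_of_nonpos (by linarith)]; ring
        · simp [hs, ht, hzero _ hs, hzero _ ht]
      rw [Finset.sum_congr rfl fun v _ => this v, Finset.sum_add_distrib, ← Finset.mul_sum,
        Finset.sum_boole]
    rw [e1, e2]
    have := hexp S h2
    nlinarith

lemma cheeger_half {V E : Type*} [Fintype V] [DecidableEq V] [Fintype E] (s t : E → V) (ε d : ℝ)
    (hε : 0 < ε)
    (hs : ∀ h : V → ℝ, ∑ e, h (s e) = d * ∑ v, h v)
    (ht : ∀ h : V → ℝ, ∑ e, h (t e) = d * ∑ v, h v)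
    (hexp : ∀ A : Finset V, 2 * A.card ≤ Fintype.card V →
      ε * A.card ≤ ((univ.filter fun e => ¬ (s e ∈ A ↔ t e ∈ A)).card : ℝ))
    (g : V → ℝ) (g0 : ∀ v, 0 ≤ g v)
    (hg : 2 * (univ.filter fun v => 0 < g v).card ≤ Fintype.card V) :
    ε ^ 2 * ∑ v, g v ^ 2 ≤ 4 * d * ∑ e, (g (s e) - g (t e)) ^ 2 := by
  have hfil : (univ.filter fun v => 0 < g v ^ 2) = (univ.filter fun v => 0 < g v) := by
    ext v; simp only [mem_filter, mem_univ, true_and]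
    constructor
    · intro h; exact lt_of_le_of_ne (g0 v) (fun hp => by rw [← hp] at h; simp at h)
    · intro h; positivity
  have h1 := coarea s t ε hexp _ (fun v => g v ^ 2) (fun v => sq_nonneg _) le_rfl
    (by rw [hfil]; exact hg)
  have h2 : ∑ e, |g (s e) ^ 2 - g (t e) ^ 2| = ∑ e, |g (s e) - g (t e)| * (g (s e) + g (t e)) := by
    refine Finset.sum_congr rfl fun e _ => ?_
    rw [sq_sub_sq, abs_mul, abs_of_nonneg (add_nonneg (g0 _) (g0 _)), mul_comm]
  have h3 := Finset.sum_mul_sq_le_sq_mul_sq univ (fun e => |g (s e) - g (t e)|)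
    (fun e => g (s e) + g (t e))
  simp only [sq_abs] at h3
  have h4 : ∑ e, (g (s e) + g (t e)) ^ 2 ≤ 4 * d * ∑ v, g v ^ 2 := by
    have a := hs (fun v => g v ^ 2)
    have b := ht (fun v => g v ^ 2)
    calc ∑ e, (g (s e) + g (t e)) ^ 2 ≤ ∑ e, (2 * g (s e) ^ 2 + 2 * g (t e) ^ 2) :=
          Finset.sum_le_sum fun e _ => by nlinarith [sq_nonneg (g (s e) - g (t e))]
      _ = _ := by
        rw [Finset.sum_add_distrib, ← Finset.mul_sum, ← Finset.mul_sum]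
        rw [a, b]; ring
  rw [h2] at h1
  set X := ∑ v, g v ^ 2
  have hX : 0 ≤ X := Finset.sum_nonneg fun v _ => sq_nonneg _
  set Y := ∑ e, (g (s e) - g (t e)) ^ 2
  have hY : 0 ≤ Y := Finset.sum_nonneg fun v _ => sq_nonneg _
  set Z := ∑ e, |g (s e) - g (t e)| * (g (s e) + g (t e))
  have h5 : (ε * X) ^ 2 ≤ Z ^ 2 := pow_le_pow_left₀ (by positivity) h1 2
  have h6 : (ε * X) ^ 2 ≤ Y * (4 * d * X) := h5.trans (h3.trans (mul_le_mul_of_nonneg_left h4 hY))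
  rcases hX.eq_or_lt with h | h
  · rw [← h] at h4 ⊢
    have : 0 ≤ ∑ e, g (s e) := Finset.sum_nonneg fun e _ => g0 _
    by_cases hV : Nonempty V
    · have := hs (fun _ => 1)
      simp at this
      have hd : 0 ≤ d * Fintype.card V := by rw [← this]; positivity
      have hc : (0:ℝ) < Fintype.card V := by exact_mod_cast Fintype.card_pos
      have : 0 ≤ d := nonneg_of_mul_nonneg_left hd hc
      simp; positivity
    · have : IsEmpty E := ⟨fun e => hV ⟨s e⟩⟩
      simp [Y]
  · by_contra hcon
    push Not at hcon
    nlinarith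

lemma exists_median {V : Type*} [Fintype V] [Nonempty V] (f : V → ℝ) :
    ∃ c, 2 * (univ.filter fun v => c < f v).card ≤ Fintype.card V ∧
      2 * (univ.filter fun v => f v < c).card ≤ Fintype.card V := by
  classical
  set S := univ.filter fun u => 2 * (univ.filter fun v => f u < f v).card ≤ Fintype.card V with hS
  have hne : S.Nonempty := by
    obtain ⟨u, _, hu⟩ := (univ : Finset V).exists_max_image f univ_nonempty
    refine ⟨u, ?_⟩
    have : (univ.filter fun v => f u < f v) = ∅ := by
      ext v; simpa using hu v (mem_univ _)
    simp [hS, this]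
  obtain ⟨u, hu, hmin⟩ := S.exists_min_image f hne
  refine ⟨f u, (mem_filter.1 hu).2, ?_⟩
  by_contra hcon
  push Not at hcon
  have hne2 : (univ.filter fun v => f v < f u).Nonempty := by
    rw [← Finset.card_pos]; omega
  obtain ⟨w, hw, hmax⟩ := (univ.filter fun v => f v < f u).exists_max_image f hne2
  have hwu : f w < f u := (mem_filter.1 hw).2
  have hwS : w ∉ S := fun h => absurd (hmin w h) (not_le.2 hwu)
  have : ¬ (2 * (univ.filter fun v => f w < f v).card ≤ Fintype.card V) := fun h => hwS (by simp [hS, h])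
  have hdis : Disjoint (univ.filter fun v => f v < f u) (univ.filter fun v => f w < f v) := by
    rw [Finset.disjoint_left]
    intro v h1 h2
    exact absurd (hmax v h1) (not_le.2 (mem_filter.1 h2).2)
  have := Finset.card_le_univ ((univ.filter fun v => f v < f u) ∪ (univ.filter fun v => f w < f v))
  rw [Finset.card_union_of_disjoint hdis] at this
  omega

lemma cheeger {V E : Type*} [Fintype V] [DecidableEq V] [Nonempty V] [Fintype E] (s t : E → V) (ε d : ℝ)
    (hε : 0 < ε)
    (hs : ∀ h : V → ℝ, ∑ e, h (s e) = d * ∑ v, h v)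
    (ht : ∀ h : V → ℝ, ∑ e, h (t e) = d * ∑ v, h v) (hd : 0 ≤ d)
    (hexp : ∀ A : Finset V, 2 * A.card ≤ Fintype.card V →
      ε * A.card ≤ ((univ.filter fun e => ¬ (s e ∈ A ↔ t e ∈ A)).card : ℝ))
    (f : V → ℝ) : ∃ c,
    ε ^ 2 * ∑ v, (f v - c) ^ 2 ≤ 4 * d * ∑ e, (f (s e) - f (t e)) ^ 2 := by
  obtain ⟨c, hc1, hc2⟩ := exists_median f
  refine ⟨c, ?_⟩
  have a := cheeger_half s t ε d hε hs ht hexp (fun v => max (f v - c) 0) (fun v => le_max_right _ _)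
    (by simpa using hc1)
  have b := cheeger_half s t ε d hε hs ht hexp (fun v => max (c - f v) 0) (fun v => le_max_right _ _)
    (by simpa using hc2)
  have e1 : ∑ v, (f v - c) ^ 2 = ∑ v, max (f v - c) 0 ^ 2 + ∑ v, max (c - f v) 0 ^ 2 := by
    rw [← Finset.sum_add_distrib]
    refine Finset.sum_congr rfl fun v _ => ?_
    rcases le_total (f v) c with h | h
    · rw [max_eq_right (by linarith), max_eq_left (by linarith)]; ring
    · rw [max_eq_left (by linarith), max_eq_right (by linarith)]; ring
  have e2 : ∑ e, (max (f (s e) - c) 0 - max (f (t e) - c) 0) ^ 2 +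
      ∑ e, (max (c - f (s e)) 0 - max (c - f (t e)) 0) ^ 2 ≤ ∑ e, (f (s e) - f (t e)) ^ 2 := by
    rw [← Finset.sum_add_distrib]
    refine Finset.sum_le_sum fun e _ => ?_
    rcases le_total (f (s e)) c with h | h <;> rcases le_total (f (t e)) c with hp | hp
    · rw [max_eq_right (by linarith), max_eq_right (by linarith), max_eq_left (by linarith), max_eq_left (by linarith)]; nlinarith
    · rw [max_eq_right (by linarith), max_eq_left (by linarith), max_eq_left (by linarith), max_eq_right (by linarith)]; nlinarith
    · rw [max_eq_left (by linarith), max_eq_right (by linarith), max_eq_right (by linarith), max_eq_left (by linarith)]; nlinarith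
    · rw [max_eq_left (by linarith), max_eq_left (by linarith), max_eq_right (by linarith), max_eq_right (by linarith)]; nlinarith
  rw [e1, mul_add]
  have := mul_le_mul_of_nonneg_left e2 (by positivity : 0 ≤ 4 * d)
  linarith

lemma div_pow_le_choose' : ∀ (a m : ℕ), 0 < a → a ≤ m → ((m : ℝ) / a) ^ a ≤ (m.choose a : ℝ) := by
  intro a
  induction a with
  | zero => intro m h; omega
  | succ a ih =>
    intro m _ hm
    obtain ⟨m, rfl⟩ : ∃ m', m = m' + 1 := ⟨m - 1, by omega⟩
    rcases Nat.eq_zero_or_pos a with h0 | h0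
    · subst h0; simp
    have h1 := ih m h0 (by omega)
    have h2 : ((m + 1).choose (a + 1) : ℝ) = ((m + 1 : ℕ) : ℝ) / (a + 1 : ℕ) * m.choose a := by
      have := Nat.add_one_mul_choose_eq m a
      have h3 : ((m + 1 : ℕ) : ℝ) * m.choose a = (m + 1).choose (a + 1) * (a + 1 : ℕ) := by
        exact_mod_cast this
      field_simp
      linarith
    rw [h2, pow_succ, mul_comm]
    refine mul_le_mul_of_nonneg_left (le_trans ?_ h1) (by positivity)
    refine pow_le_pow_left₀ (by positivity) ?_ _
    have : (a : ℝ) ≤ m := by exact_mod_cast (by omega : a ≤ m)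
    have ha : (0 : ℝ) < a := by exact_mod_cast h0
    rw [div_le_div_iff₀ (by positivity) ha]
    push_cast
    nlinarith

lemma sum_choose_bound (m r : ℕ) (x : ℝ) (hx : 0 < x) (hx1 : x ≤ 1) :
    (∑ j ∈ range (r + 1), (m.choose j : ℝ)) * x ^ r ≤ Real.exp (x * m) := by
  have h1 : (1 + x) ^ m ≤ Real.exp (x * m) := by
    rw [mul_comm, Real.exp_nat_mul]
    exact pow_le_pow_left₀ (by positivity) (by linarith [Real.add_one_le_exp x]) _
  refine le_trans ?_ h1
  rw [add_comm 1 x, add_pow, Finset.sum_mul]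
  have h2 : ∀ j ∈ range (r + 1), (m.choose j : ℝ) * x ^ r ≤ x ^ j * 1 ^ (m - j) * m.choose j := by
    intro j hj
    rw [one_pow, mul_one, mul_comm]
    exact mul_le_mul_of_nonneg_right (pow_le_pow_of_le_one hx.le hx1 (by simp at hj; omega)) (by positivity)
  refine (Finset.sum_le_sum h2).trans ?_
  have h3 : ∑ j ∈ range (m + 1), x ^ j * 1 ^ (m - j) * (m.choose j : ℝ) =
      ∑ j ∈ range (max r m + 1), x ^ j * 1 ^ (m - j) * (m.choose j : ℝ) := by
    refine Finset.sum_subset (by intro j; simp; omega) ?_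
    intro j _ hj
    simp at hj
    rw [Nat.choose_eq_zero_of_lt (by omega)]; simp
  rw [h3]
  refine Finset.sum_le_sum_of_subset_of_nonneg (by intro j; simp; omega) ?_
  intros; positivity

lemma T_bound (m a : ℕ) (ha : 0 < a) (ham : 2 * a ≤ m) :
    (∑ j ∈ range (a / 40 + 1), m.choose j) ^ 4 ≤ m.choose a := by
  set r := a / 40 with hr
  have hr' : 40 * r ≤ a := by omega
  have ha' : (0 : ℝ) < a := by exact_mod_cast ha
  have hm' : (0 : ℝ) < m := by exact_mod_cast (by omega : 0 < m)
  have ham' : 2 * (a : ℝ) ≤ m := by exact_mod_cast ham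
  set T : ℝ := ∑ j ∈ range (r + 1), (m.choose j : ℝ) with hT
  have hT0 : 0 ≤ T := Finset.sum_nonneg fun _ _ => by positivity
  set y : ℝ := (m : ℝ) / a with hy
  have hy2 : 2 ≤ y := by rw [hy, le_div_iff₀ ha']; exact ham'
  have h1 := sum_choose_bound m r ((16 * y)⁻¹) (by positivity) (inv_le_one_of_one_le₀ (by linarith))
  rw [← hT] at h1
  have h2 : (16 * y)⁻¹ * m = a / 16 := by rw [hy]; field_simp
  rw [h2, inv_pow, ← div_eq_mul_inv, div_le_iff₀ (by positivity)] at h1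
  have h3 : (16 * y) ^ r ≤ y ^ (5 * r) := by
    rw [pow_mul]
    refine pow_le_pow_left₀ (by positivity) ?_ _
    have : (2 : ℝ) ^ 4 ≤ y ^ 4 := pow_le_pow_left₀ (by norm_num) hy2 4
    nlinarith
  have h4 : T ^ 8 ≤ (y ^ a) ^ 2 := by
    calc T ^ 8 ≤ (Real.exp (a / 16) * y ^ (5 * r)) ^ 8 :=
          pow_le_pow_left₀ hT0 (h1.trans (mul_le_mul_of_nonneg_left h3 (Real.exp_pos _).le)) 8
      _ = (Real.exp (1 / 2)) ^ a * y ^ (40 * r) := by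
          rw [mul_pow, ← Real.exp_nat_mul, ← Real.exp_nat_mul, ← pow_mul]
          congr 2
          · push_cast; ring
          · ring
      _ ≤ y ^ a * y ^ a := by
          refine mul_le_mul (pow_le_pow_left₀ (Real.exp_pos _).le (le_trans ?_ hy2) _)
            (pow_le_pow_right₀ (by linarith) hr') (by positivity) (by positivity)
          have e1 : Real.exp (1 / 2) ^ 2 = Real.exp 1 := by
            rw [← Real.exp_nat_mul]; norm_num
          have := Real.exp_one_lt_d9
          nlinarith [Real.exp_pos (1 / 2)]
      _ = _ := by ring
  have h5 : T ^ 4 ≤ y ^ a := by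
    refine le_of_sq_le_sq ?_ (by positivity)
    calc (T ^ 4) ^ 2 = T ^ 8 := by ring
      _ ≤ _ := h4
  have h6 := h5.trans (div_pow_le_choose' a m ha (by omega))
  rw [hT] at h6
  exact_mod_cast h6

/-- boundary on the cycle -/
def bdry (m : ℕ) [NeZero m] (A : Finset (ZMod m)) : Finset (ZMod m) :=
  univ.filter fun i => ¬ (i ∈ A ↔ i + 1 ∈ A)

lemma bdry_inj (m : ℕ) [NeZero m] (A B : Finset (ZMod m)) (h : bdry m A = bdry m B)
    (h0 : 0 ∈ A ↔ 0 ∈ B) : A = B := by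
  have key : ∀ n : ℕ, ((n : ZMod m) ∈ A ↔ (n : ZMod m) ∈ B) := by
    intro n
    induction n with
    | zero => simpa using h0
    | succ n ih =>
      have := Finset.ext_iff.1 h (n : ZMod m)
      simp only [bdry, mem_filter, mem_univ, true_and] at this
      push_cast
      tauto
  ext i
  have := key i.val
  rwa [ZMod.natCast_val, ZMod.cast_id] at this

def low (m : ℕ) [NeZero m] (a r : ℕ) : Finset (Finset (ZMod m)) :=
  (powersetCard a univ).filter fun A => (bdry m A).card ≤ r

lemma low_card (m : ℕ) [NeZero m] (a r : ℕ) :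
    (low m a r).card ≤ 2 * ∑ j ∈ range (r + 1), m.choose j := by
  have h1 : (low m a r).card ≤
      ((univ : Finset Bool) ×ˢ ((range (r + 1)).biUnion fun j => powersetCard j (univ : Finset (ZMod m)))).card := by
    refine Finset.card_le_card_of_injOn (fun A => (decide (0 ∈ A), bdry m A)) ?_ ?_
    · intro A hA
      simp only [low, coe_filter, Set.mem_ofPred_eq] at hA
      rw [mem_coe, mem_product, mem_biUnion]
      exact ⟨mem_univ _, _, mem_range.2 (Nat.lt_succ_of_le hA.2),
        mem_powersetCard.2 ⟨subset_univ _, rfl⟩⟩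
    · intro A _ B _ h
      simp at h
      exact bdry_inj m A B h.2 h.1
  refine h1.trans ?_
  rw [card_product]
  simp only [card_univ, Fintype.card_bool]
  refine Nat.mul_le_mul_left _ (Finset.card_biUnion_le.trans ?_)
  simp [card_powersetCard, ZMod.card]

lemma low_zero (m : ℕ) [NeZero m] (a : ℕ) (ha : 0 < a) (ham : a < m) : low m a 0 = ∅ := by
  rw [Finset.eq_empty_iff_forall_notMem]
  intro A hA
  simp only [low, mem_filter, mem_powersetCard, Nat.le_zero, card_eq_zero] at hA
  obtain ⟨⟨-, hc⟩, hb⟩ := hA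
  by_cases h0 : (0 : ZMod m) ∈ A
  · have := bdry_inj m A univ (by rw [hb]; simp [bdry]) (by simp [h0])
    rw [this, card_univ, ZMod.card] at hc
    omega
  · have := bdry_inj m A ∅ (by rw [hb]; simp [bdry]) (by simp [h0])
    rw [this] at hc
    simp at hc
    omega

lemma exists_perm_map {α : Type*} [Fintype α] [DecidableEq α] (A B : Finset α) (h : A.card = B.card) :
    ∃ τ : Equiv.Perm α, A.map τ.toEmbedding = B := by
  have e : {x // x ∈ A} ≃ {x // x ∈ B} := Finset.equivOfCardEq h
  refine ⟨e.extendSubtype, ?_⟩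
  refine Finset.eq_of_subset_of_card_le ?_ (by simp [h])
  intro x hx
  simp only [mem_map, Equiv.coe_toEmbedding] at hx
  obtain ⟨y, hy, rfl⟩ := hx
  exact e.extendSubtype_mem y hy

lemma perm_count {α : Type*} [Fintype α] [DecidableEq α] (A B : Finset α) (a : ℕ) (hA : A.card = a)
    (hB : B.card = a) :
    (univ.filter fun σ : Equiv.Perm α => B.map σ.toEmbedding = A).card * (Fintype.card α).choose a =
      (Fintype.card α).factorial := by
  have h1 : ∀ A' ∈ powersetCard a (univ : Finset α),
      (univ.filter fun σ : Equiv.Perm α => B.map σ.toEmbedding = A').card =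
      (univ.filter fun σ : Equiv.Perm α => B.map σ.toEmbedding = A).card := by
    intro A' hA'
    obtain ⟨τ, hτ⟩ := exists_perm_map A' A (by rw [hA, (mem_powersetCard.1 hA').2])
    refine Finset.card_bij (fun σ _ => τ * σ) ?_ ?_ ?_
    · intro σ hσ
      simp only [mem_filter, mem_univ, true_and] at hσ ⊢
      rw [← hτ, ← hσ, Finset.map_map]; rfl
    · intro σ _ σ' _ h; exact mul_left_cancel h
    · intro σ hσ
      simp only [mem_filter, mem_univ, true_and] at hσ
      refine ⟨τ⁻¹ * σ, ?_, by simp⟩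
      simp only [mem_filter, mem_univ, true_and]
      apply Finset.map_injective τ.toEmbedding
      rw [hτ, ← hσ, Finset.map_map]
      congr 1
      ext x; simp
  have h2 := Finset.card_eq_sum_card_fiberwise (s := (univ : Finset (Equiv.Perm α)))
    (t := powersetCard a (univ : Finset α)) (f := fun σ => B.map σ.toEmbedding)
    (by intro σ _; simp [hB])
  rw [Finset.sum_congr rfl h1] at h2
  simp only [sum_const, card_powersetCard, card_univ, smul_eq_mul, Fintype.card_perm] at h2
  rw [h2, mul_comm]

lemma exists_good_perm (m : ℕ) [NeZero m] : ∃ σ : Equiv.Perm (ZMod m),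
    ∀ A B : Finset (ZMod m), 0 < A.card → 2 * A.card ≤ m → B.map σ.toEmbedding = A →
      (bdry m A).card ≤ A.card / 40 → ¬ (bdry m B).card ≤ A.card / 40 := by
  by_contra hcon
  push Not at hcon
  have hm : 0 < m := Nat.pos_of_ne_zero (NeZero.ne m)
  set bad : ℕ → Finset (Equiv.Perm (ZMod m)) := fun a =>
    (low m a (a / 40) ×ˢ low m a (a / 40)).biUnion fun p =>
      univ.filter fun σ : Equiv.Perm (ZMod m) => p.2.map σ.toEmbedding = p.1 with hbad
  have hcover : (univ : Finset (Equiv.Perm (ZMod m))) ⊆ (Icc 1 (m / 2)).biUnion bad := by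
    intro σ _
    obtain ⟨A, B, hA, hA2, hAB, hbA, hbB⟩ := hcon σ
    have hcB : B.card = A.card := by rw [← hAB, card_map]
    simp only [hbad, mem_biUnion, mem_Icc]
    refine ⟨A.card, by omega, (A, B), ?_, ?_⟩
    · simp [low, hbA, hbB, hcB]
    · simpa using hAB
  have hbadc : ∀ a ∈ Icc 1 (m / 2), (bad a).card * (m + 1) ^ 2 ≤ 4 * m.factorial := by
    intro a ha
    rw [mem_Icc] at ha
    rcases Nat.eq_zero_or_pos (a / 40) with h0 | h0
    · have : bad a = ∅ := by
        simp only [hbad, h0]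
        rw [low_zero m a (by omega) (by omega)]; simp
      rw [this]; simp
    set T := ∑ j ∈ range (a / 40 + 1), m.choose j with hT
    have hT1 : m + 1 ≤ T := by
      have : ∑ j ∈ range 2, m.choose j ≤ T :=
        Finset.sum_le_sum_of_subset (by intro j; simp; omega)
      simp [Finset.sum_range_succ] at this
      omega
    have hT4 : T ^ 4 ≤ m.choose a := T_bound m a (by omega) (by omega)
    have hl := low_card m a (a / 40)
    rw [← hT] at hl
    have hC : 0 < m.choose a := Nat.choose_pos (by omega)
    have hb : (bad a).card * m.choose a ≤ (low m a (a / 40)).card ^ 2 * m.factorial := by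
      have h1 : (bad a).card ≤ _ := Finset.card_biUnion_le
      refine (Nat.mul_le_mul_right _ h1).trans ?_
      rw [Finset.sum_mul]
      have h2 : ∀ p ∈ low m a (a / 40) ×ˢ low m a (a / 40),
          (univ.filter fun σ : Equiv.Perm (ZMod m) => p.2.map σ.toEmbedding = p.1).card * m.choose a
            = m.factorial := by
        intro p hp
        simp [low] at hp
        have := perm_count p.1 p.2 a hp.1.1 hp.2.1
        rwa [ZMod.card] at this
      rw [Finset.sum_congr rfl h2, sum_const, card_product, smul_eq_mul, sq]
    refine Nat.le_of_mul_le_mul_right ?_ hC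
    calc (bad a).card * (m + 1) ^ 2 * m.choose a = ((bad a).card * m.choose a) * (m + 1) ^ 2 := by ring
      _ ≤ ((low m a (a / 40)).card ^ 2 * m.factorial) * T ^ 2 :=
          Nat.mul_le_mul hb (Nat.pow_le_pow_left hT1 2)
      _ ≤ ((2 * T) ^ 2 * m.factorial) * T ^ 2 := by gcongr
      _ = 4 * m.factorial * T ^ 4 := by ring
      _ ≤ 4 * m.factorial * m.choose a := by gcongr
  have h1 := Finset.card_le_card hcover
  rw [card_univ, Fintype.card_perm, ZMod.card] at h1
  have h2 : m.factorial * (m + 1) ^ 2 ≤ (m / 2) * (4 * m.factorial) := by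
    refine (Nat.mul_le_mul_right _ (h1.trans Finset.card_biUnion_le)).trans ?_
    rw [Finset.sum_mul]
    refine (Finset.sum_le_sum hbadc).trans ?_
    simp
  have hf := Nat.factorial_pos m
  have h3 : (m + 1) ^ 2 ≤ (m / 2) * 4 := by
    refine Nat.le_of_mul_le_mul_left ?_ hf
    calc _ ≤ _ := h2
      _ = _ := by ring
  have : m / 2 * 4 ≤ 2 * m := by omega
  nlinarith

/-- Poincare inequality for two cycles -/
lemma poincare_two (m : ℕ) [NeZero m] : ∃ σ : Equiv.Perm (ZMod m), ∀ f : ZMod m → ℝ, ∃ c : ℝ,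
    ∑ i, (f i - c) ^ 2 ≤ 12800 * (∑ i, (f i - f (i + 1)) ^ 2 +
      ∑ i, (f (σ i) - f (σ (i + 1))) ^ 2) := by
  obtain ⟨σ, hσ⟩ := exists_good_perm m
  refine ⟨σ, fun f => ?_⟩
  have hshift : ∀ h : ZMod m → ℝ, ∑ i, h (i + 1) = ∑ i, h i :=
    fun h => Equiv.sum_comp (Equiv.addRight (1 : ZMod m)) h
  have hperm : ∀ h : ZMod m → ℝ, ∑ i, h (σ i) = ∑ i, h i := fun h => Equiv.sum_comp σ h
  obtain ⟨c, hc⟩ := cheeger (V := ZMod m) (E := ZMod m ⊕ ZMod m)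
    (Sum.elim (fun i => i) (fun i => σ i)) (Sum.elim (fun i => i + 1) (fun i => σ (i + 1)))
    (1 / 40) 2 (by norm_num)
    (by intro h; simp only [Fintype.sum_sum_type, Sum.elim_inl, Sum.elim_inr]; rw [hperm]; ring)
    (by
      intro h; simp only [Fintype.sum_sum_type, Sum.elim_inl, Sum.elim_inr]
      rw [hshift (fun i => h (σ i)), hshift, hperm]; ring)
    (by norm_num)
    (by
      intro A hA
      rw [ZMod.card] at hA
      rcases Nat.eq_zero_or_pos A.card with h0 | h0
      · rw [h0]; simp
      set B := A.map σ.symm.toEmbedding with hB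
      have hBA : B.map σ.toEmbedding = A := by
        rw [hB, Finset.map_map]; ext x; simp
      have hmB : ∀ i, i ∈ B ↔ σ i ∈ A := by
        intro i; simp [hB, Finset.mem_map_equiv]
      set X := (univ.filter fun e : ZMod m ⊕ ZMod m =>
        ¬ (Sum.elim (fun i => i) (fun i => σ i) e ∈ A ↔
          Sum.elim (fun i => i + 1) (fun i => σ (i + 1)) e ∈ A)) with hX
      have h1 : (bdry m A).card ≤ X.card := by
        refine Finset.card_le_card_of_injOn Sum.inl ?_ (fun _ _ _ _ h => Sum.inl_injective h)
        intro i hi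
        simpa [bdry, hX] using hi
      have h2 : (bdry m B).card ≤ X.card := by
        refine Finset.card_le_card_of_injOn Sum.inr ?_ (fun _ _ _ _ h => Sum.inr_injective h)
        intro i hi
        simpa [bdry, hX, hmB] using hi
      have h3 : A.card ≤ 40 * X.card := by
        by_contra hcon
        exact hσ A B h0 hA hBA (by omega) (by omega)
      have h4 : (A.card : ℝ) ≤ 40 * X.card := by exact_mod_cast h3
      linarith) f
  refine ⟨c, ?_⟩
  simp only [Fintype.sum_sum_type, Sum.elim_inl, Sum.elim_inr] at hc
  linarith

open Classical in
/-- Dirichlet energy (each edge counted twice) -/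
noncomputable def dir {V : Type*} [Fintype V] (G : SimpleGraph V) (x : V → ℝ) : ℝ :=
  ∑ v, ∑ w, if G.Adj v w then (x v - x w) ^ 2 else 0

lemma dir_nonneg {V : Type*} [Fintype V] (G : SimpleGraph V) (x : V → ℝ) : 0 ≤ dir G x := by
  unfold dir
  exact Finset.sum_nonneg fun v _ => Finset.sum_nonneg fun w _ => by split_ifs <;> positivity

def PI {V : Type*} [Fintype V] (G : SimpleGraph V) (K : ℝ) : Prop :=
  ∀ x : V → ℝ, ∃ c : ℝ, ∑ v, (x v - c) ^ 2 ≤ K * dir G x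

lemma lap_quad {V : Type*} [Fintype V] (G : SimpleGraph V) (x : V → ℝ) :
    x ⬝ᵥ (lap G).mulVec x = dir G x / 2 := by
  classical
  have : lap G = G.lapMatrix ℝ := by
    ext i j
    simp only [lap, Matrix.of_apply, SimpleGraph.lapMatrix, SimpleGraph.degMatrix,
      Matrix.sub_apply, Matrix.diagonal_apply, SimpleGraph.adjMatrix_apply]
    by_cases h : i = j
    · subst h
      simp only [if_true, SimpleGraph.irrefl, if_false, sub_zero]
      rw [← SimpleGraph.card_neighborFinset_eq_degree, ← Set.ncard_coe_finset]
      congr 2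
      ext k; simp
    · simp only [h, if_false]
      split_ifs <;> simp
  have h2 := SimpleGraph.lapMatrix_toLinearMap₂' (R := ℝ) G x
  rw [Matrix.toLinearMap₂'_apply'] at h2
  rw [this, h2, dir]

lemma lambda2_ge {n : ℕ} (hn : 2 ≤ n) (G : SimpleGraph (Fin n)) (K : ℝ) (hK : 0 < K) (h : PI G K) :
    1 / (2 * K) ≤ lambda2 (lap G) := by
  unfold lambda2
  refine le_csInf ?_ ?_
  · obtain ⟨n, rfl⟩ : ∃ n', n = n' + 2 := ⟨n - 2, by omega⟩
    refine ⟨_, fun i => if i = 0 then √2⁻¹ else if i = 1 then -√2⁻¹ else 0, ?_, ?_, rfl⟩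
    · rw [Fin.sum_univ_succ, Fin.sum_univ_succ]
      simp [Fin.ext_iff]
    · rw [Fin.sum_univ_succ, Fin.sum_univ_succ]
      simp [Fin.ext_iff]
      norm_num
  · rintro r ⟨x, h0, h1, rfl⟩
    obtain ⟨c, hc⟩ := h x
    have e : ∑ v, (x v - c) ^ 2 = 1 + n * c ^ 2 := by
      have : ∀ v, (x v - c) ^ 2 = x v ^ 2 - 2 * c * x v + c ^ 2 := fun v => by ring
      rw [Finset.sum_congr rfl fun v _ => this v, Finset.sum_add_distrib, Finset.sum_sub_distrib,
        ← Finset.mul_sum, h0, h1]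
      simp
    rw [lap_quad, div_le_iff₀ (by positivity)]
    have : (0 : ℝ) ≤ n * c ^ 2 := by positivity
    nlinarith

lemma transfer {V W : Type*} [Fintype V] [Fintype W] (e : W ≃ V) (G : SimpleGraph V) (k : ℕ) (K : ℝ)
    (hreg : ∀ v, {w | G.Adj v w}.ncard = k) (h : PI G K) :
    (∀ v, {w | (G.comap e).Adj v w}.ncard = k) ∧ PI (G.comap e) K := by
  constructor
  · intro v
    rw [← hreg (e v), ← Set.ncard_image_of_injective _ e.injective]
    congr 1
    ext w
    simp only [SimpleGraph.comap_adj, Set.mem_image, Set.mem_ofPred_eq]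
    constructor
    · rintro ⟨u, hu, rfl⟩; exact hu
    · intro hw; exact ⟨e.symm w, by simpa using hw, by simp⟩
  · intro x
    obtain ⟨c, hc⟩ := h (x ∘ e.symm)
    refine ⟨c, ?_⟩
    have e1 : ∑ v, ((x ∘ e.symm) v - c) ^ 2 = ∑ v, (x v - c) ^ 2 :=
      Equiv.sum_comp e.symm (fun v => (x v - c) ^ 2)
    have e2 : dir G (x ∘ e.symm) = dir (G.comap e) x := by
      unfold dir
      rw [← Equiv.sum_comp e]
      refine Finset.sum_congr rfl fun v _ => ?_
      rw [← Equiv.sum_comp e]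
      refine Finset.sum_congr rfl fun w _ => ?_
      simp only [Function.comp, Equiv.symm_apply_apply, SimpleGraph.comap_adj]
      congr!
    rw [← e1, ← e2]; exact hc

/-- Remove a matching and add a vertex. -/
def surg {V : Type*} (G : SimpleGraph V) (M : Set V) (τ : V → V) (hτ : ∀ v, τ (τ v) = v)
    (hM : ∀ v, τ v ∈ M ↔ v ∈ M) : SimpleGraph (Option V) where
  Adj a b := match a, b with
    | none, none => False
    | none, some v => v ∈ M
    | some v, none => v ∈ M
    | some u, some v => G.Adj u v ∧ ¬ (u ∈ M ∧ v = τ u)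
  symm := ⟨by
    rintro (_ | u) (_ | v) h
    · exact h
    · exact h
    · exact h
    · refine ⟨h.1.symm, fun hp => h.2 ?_⟩
      obtain ⟨h1, rfl⟩ := hp
      exact ⟨(hM v).2 h1, (hτ v).symm⟩⟩
  loopless := ⟨by
    rintro (_ | u) h
    · exact h
    · exact h.1.ne rfl⟩

lemma surg_good {V : Type*} [Fintype V] (G : SimpleGraph V) (M : Finset V) (τ : V ≃ V)
    (hτ : ∀ v, τ (τ v) = v) (hM : ∀ v, τ v ∈ (M : Set V) ↔ v ∈ (M : Set V)) (k : ℕ) (K : ℝ)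
    (hK : 0 ≤ K)
    (hadj : ∀ v ∈ M, G.Adj v (τ v)) (hc : M.card = k) (hk : 0 < k)
    (hreg : ∀ v, {w | G.Adj v w}.ncard = k) (h : PI G K) :
    (∀ v, {w | (surg G M τ hτ hM).Adj v w}.ncard = k) ∧ PI (surg G M τ hτ hM) (1 + 6 * K) := by
  classical
  set G' := surg G M τ hτ hM with hG'
  constructor
  · rintro (_ | u)
    · have : {w | G'.Adj none w} = some '' (M : Set V) := by
        ext w
        rcases w with _ | w
        · simp [hG', surg]
        · simp [hG', surg]
      rw [this, Set.ncard_image_of_injective _ (Option.some_injective _), Set.ncard_coe_finset, hc]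
    · by_cases hu : u ∈ M
      · have : {w | G'.Adj (some u) w} = insert none (some '' ({w | G.Adj u w} \ {τ u})) := by
          ext w
          rcases w with _ | w
          · simp [hG', surg, hu]
          · simp [hG', surg, hu]
        rw [this, Set.ncard_insert_of_notMem (by simp) (Set.toFinite _),
          Set.ncard_image_of_injective _ (Option.some_injective _),
          Set.ncard_sdiff_singleton_add_one (s := {w | G.Adj u w}) (hadj u hu) (Set.toFinite _), hreg]
      · have : {w | G'.Adj (some u) w} = some '' {w | G.Adj u w} := by
          ext w
          rcases w with _ | w
          · simp [hG', surg, hu]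
          · simp [hG', surg, hu]
        rw [this, Set.ncard_image_of_injective _ (Option.some_injective _), hreg]
  · intro F
    set f : V → ℝ := fun v => F (some v) with hf
    set w := F none with hw
    set D := ∑ u, ∑ v, (if G.Adj u v ∧ ¬ (u ∈ M ∧ v = τ u) then (f u - f v) ^ 2 else 0) with hD
    set S := ∑ u, (if u ∈ M then (f u - w) ^ 2 else 0) with hS
    have hD0 : 0 ≤ D := Finset.sum_nonneg fun v _ => Finset.sum_nonneg fun w _ => by
      split_ifs <;> positivity
    have hS0 : 0 ≤ S := Finset.sum_nonneg fun v _ => by split_ifs <;> positivity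
    have e1 : dir G' F = D + 2 * S := by
      unfold dir
      rw [Fintype.sum_option]
      simp only [Fintype.sum_option]
      rw [Finset.sum_add_distrib]
      have a1 : (if G'.Adj none none then (F none - F none) ^ 2 else 0) = 0 := by simp
      have a2 : ∑ v, (if G'.Adj none (some v) then (F none - F (some v)) ^ 2 else 0) = S := by
        refine Finset.sum_congr rfl fun v _ => ?_
        simp only [hG', surg, mem_coe, hf, hw]
        split_ifs <;> ring
      have a3 : ∑ v, (if G'.Adj (some v) none then (F (some v) - F none) ^ 2 else 0) = S := by
        refine Finset.sum_congr rfl fun v _ => ?_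
        simp only [hG', surg, mem_coe, hf, hw]
      have a4 : ∑ u, ∑ v, (if G'.Adj (some u) (some v) then (F (some u) - F (some v)) ^ 2 else 0) = D := by
        refine Finset.sum_congr rfl fun v _ => Finset.sum_congr rfl fun w _ => ?_
        simp only [hG', surg, mem_coe, hf]
      rw [a1, a2, a3, a4]; ring
    have e2 : dir G f ≤ D + 4 * S := by
      have b1 : dir G f ≤ D + ∑ u, ∑ v, (if v = τ u then
          (if u ∈ M then 2 * (f u - w) ^ 2 + 2 * (f (τ u) - w) ^ 2 else 0) else 0) := by
        rw [hD, ← Finset.sum_add_distrib]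
        refine Finset.sum_le_sum fun u _ => ?_
        rw [← Finset.sum_add_distrib]
        refine Finset.sum_le_sum fun v _ => ?_
        by_cases h1 : G.Adj u v
        · by_cases h2 : u ∈ M <;> by_cases h3 : v = τ u
          · subst h3; simp [h1, h2]
            nlinarith [sq_nonneg ((f u - w) + (f (τ u) - w))]
          · simp [h1, h2, h3]
          · simp [h2]
          · simp [h2, h3]
        · simp only [h1, false_and, if_false]
          split_ifs <;> positivity
      have b2 : ∑ u, ∑ v, (if v = τ u then
          (if u ∈ M then 2 * (f u - w) ^ 2 + 2 * (f (τ u) - w) ^ 2 else 0) else 0) = 4 * S := by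
        simp only [Finset.sum_ite_eq', mem_univ, if_true]
        have b3 : S = ∑ u, (if u ∈ M then (f (τ u) - w) ^ 2 else 0) := by
          rw [hS, ← Equiv.sum_comp τ]
          refine Finset.sum_congr rfl fun u _ => ?_
          have := hM u
          simp only [mem_coe] at this
          simp only [this]
        have b4 : (4 : ℝ) * S = 2 * S + 2 * S := by ring
        rw [b4]
        nth_rewrite 2 [b3]
        rw [hS, Finset.mul_sum, Finset.mul_sum, ← Finset.sum_add_distrib]
        refine Finset.sum_congr rfl fun u _ => ?_
        split_ifs <;> ring
      linarith
    obtain ⟨c, hc'⟩ := h f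
    refine ⟨c, ?_⟩
    rw [Fintype.sum_option]
    obtain ⟨u0, hu0⟩ : M.Nonempty := by rw [← Finset.card_pos]; omega
    have c1 : (f u0 - w) ^ 2 ≤ S := by
      have := Finset.single_le_sum (f := fun u => if u ∈ M then (f u - w) ^ 2 else 0)
        (fun v _ => by split_ifs <;> positivity) (mem_univ u0)
      rw [if_pos hu0] at this
      exact this
    have c2 : (f u0 - c) ^ 2 ≤ ∑ v, (f v - c) ^ 2 :=
      Finset.single_le_sum (f := fun u => (f u - c) ^ 2) (fun v _ => sq_nonneg _) (mem_univ u0)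
    have c3 : (w - c) ^ 2 ≤ 2 * (f u0 - w) ^ 2 + 2 * (f u0 - c) ^ 2 := by
      nlinarith [sq_nonneg ((f u0 - w) + (f u0 - c))]
    have c4 : K * dir G f ≤ K * (2 * dir G' F) := mul_le_mul_of_nonneg_left (by linarith) hK
    change (w - c) ^ 2 + ∑ v, (f v - c) ^ 2 ≤ _
    rw [e1] at c4 ⊢
    nlinarith

/-- Two cycles joined by `k - 2` matchings. -/
def gr (m k : ℕ) [NeZero m] (σ : Equiv.Perm (ZMod m)) (hm : 3 ≤ m) :
    SimpleGraph (ZMod m ⊕ ZMod m) where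
  Adj a b := match a, b with
    | .inl i, .inl j => j = i + 1 ∨ i = j + 1
    | .inr i, .inr j => j = i + 1 ∨ i = j + 1
    | .inl i, .inr j => ∃ t : ℕ, t < k - 2 ∧ i = σ j + t
    | .inr j, .inl i => ∃ t : ℕ, t < k - 2 ∧ i = σ j + t
  symm := ⟨by
    rintro (i | i) (j | j) h
    · exact h.symm
    · exact h
    · exact h
    · exact h.symm⟩
  loopless := ⟨by
    have h1 : (1 : ZMod m) ≠ 0 := by
      have : Fact (1 < m) := ⟨by omega⟩
      exact one_ne_zero
    rintro (i | i) h
    · rcases h with h | h <;> exact h1 (by simpa using h)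
    · rcases h with h | h <;> exact h1 (by simpa using h)⟩

lemma cyc_card (m : ℕ) [NeZero m] (hm : 3 ≤ m) (i : ZMod m) :
    {j : ZMod m | j = i + 1 ∨ i = j + 1}.ncard = 2 := by
  have : {j : ZMod m | j = i + 1 ∨ i = j + 1} = {i + 1, i - 1} := by
    ext j; simp [eq_sub_iff_add_eq, eq_comm (a := i)]
  rw [this, Set.ncard_pair]
  intro h
  have h2 : ((2 : ℕ) : ZMod m) = 0 := by
    push_cast
    linear_combination h
  rw [ZMod.natCast_eq_zero_iff] at h2
  exact absurd (Nat.le_of_dvd (by norm_num) h2) (by omega)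

lemma cast_injOn (m q : ℕ) (hq : q ≤ m) : Set.InjOn (fun t : ℕ => (t : ZMod m)) (range q : Finset ℕ) := by
  intro a ha b hb h
  simp at ha hb
  have := (ZMod.natCast_eq_natCast_iff' a b m).1 h
  rwa [Nat.mod_eq_of_lt (by omega), Nat.mod_eq_of_lt (by omega)] at this

lemma gr_reg (m k : ℕ) [NeZero m] (σ : Equiv.Perm (ZMod m)) (hm : 3 ≤ m) (hk : 2 ≤ k) (hkm : k ≤ m) :
    ∀ v, {w | (gr m k σ hm).Adj v w}.ncard = k := by
  have hinj := cast_injOn m (k - 2) (by omega)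
  rintro (i | i)
  · have : {w | (gr m k σ hm).Adj (.inl i) w} = Sum.inl '' {j : ZMod m | j = i + 1 ∨ i = j + 1} ∪
        Sum.inr '' ((fun t : ℕ => σ.symm (i - t)) '' (range (k - 2) : Finset ℕ)) := by
      ext w
      rcases w with j | j
      · simp [gr]
      · simp only [gr, Set.mem_ofPred_eq, Set.mem_union, Set.mem_image, coe_range, Set.mem_Iio]
        constructor
        · rintro ⟨t, ht, rfl⟩; exact Or.inr ⟨j, ⟨t, ht, by simp⟩, rfl⟩
        · rintro (⟨x, _, hx⟩ | ⟨x, ⟨t, ht, h1⟩, hx⟩)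
          · cases hx
          · cases hx; exact ⟨t, ht, by rw [← h1]; simp⟩
    rw [this, Set.ncard_union_eq (by
      rw [Set.disjoint_left]; rintro _ ⟨x, _, rfl⟩ ⟨y, _, hy⟩; cases hy) (Set.toFinite _) (Set.toFinite _),
      Set.ncard_image_of_injective _ Sum.inl_injective, Set.ncard_image_of_injective _ Sum.inr_injective,
      cyc_card m hm, Set.InjOn.ncard_image, Set.ncard_coe_finset, card_range]
    · omega
    · intro a ha b hb h
      exact hinj ha hb (by simpa using h)
  · have : {w | (gr m k σ hm).Adj (.inr i) w} = Sum.inr '' {j : ZMod m | j = i + 1 ∨ i = j + 1} ∪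
        Sum.inl '' ((fun t : ℕ => σ i + t) '' (range (k - 2) : Finset ℕ)) := by
      ext w
      rcases w with j | j
      · simp only [gr, Set.mem_ofPred_eq, Set.mem_union, Set.mem_image, coe_range, Set.mem_Iio]
        constructor
        · rintro ⟨t, ht, rfl⟩; exact Or.inr ⟨_, ⟨t, ht, rfl⟩, rfl⟩
        · rintro (⟨x, _, hx⟩ | ⟨x, ⟨t, ht, h1⟩, hx⟩)
          · cases hx
          · cases hx; exact ⟨t, ht, h1.symm⟩
      · simp [gr]
    rw [this, Set.ncard_union_eq (by
      rw [Set.disjoint_left]; rintro _ ⟨x, _, rfl⟩ ⟨y, _, hy⟩; cases hy) (Set.toFinite _) (Set.toFinite _),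
      Set.ncard_image_of_injective _ Sum.inr_injective, Set.ncard_image_of_injective _ Sum.inl_injective,
      cyc_card m hm, Set.InjOn.ncard_image, Set.ncard_coe_finset, card_range]
    · omega
    · intro a ha b hb h
      exact hinj ha hb (by simpa using h)

lemma gr_PI (m k : ℕ) [NeZero m] (σ : Equiv.Perm (ZMod m)) (hm : 3 ≤ m) (hk : 3 ≤ k)
    (hσ : ∀ f : ZMod m → ℝ, ∃ c : ℝ,
    ∑ i, (f i - c) ^ 2 ≤ 12800 * (∑ i, (f i - f (i + 1)) ^ 2 +
      ∑ i, (f (σ i) - f (σ (i + 1))) ^ 2)) : PI (gr m k σ hm) 1000000 := by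
  classical
  intro F
  set f : ZMod m → ℝ := fun i => F (.inl i) with hf
  set h : ZMod m → ℝ := fun i => F (.inr i) with hh
  have hshift : ∀ h : ZMod m → ℝ, ∑ i, h (i + 1) = ∑ i, h i :=
    fun h => Equiv.sum_comp (Equiv.addRight (1 : ZMod m)) h
  have hperm : ∀ h : ZMod m → ℝ, ∑ i, h (σ i) = ∑ i, h i := fun h => Equiv.sum_comp σ h
  set P := ∑ i, (f i - f (i + 1)) ^ 2
  set Q := ∑ i, (h i - h (i + 1)) ^ 2
  set X := ∑ i, (h i - f (σ i)) ^ 2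
  have hP : 0 ≤ P := Finset.sum_nonneg fun _ _ => sq_nonneg _
  have hQ : 0 ≤ Q := Finset.sum_nonneg fun _ _ => sq_nonneg _
  have hX : 0 ≤ X := Finset.sum_nonneg fun _ _ => sq_nonneg _
  have e1 : P + Q + X ≤ dir (gr m k σ hm) F := by
    unfold dir
    have nn : ∀ v w, 0 ≤ (if (gr m k σ hm).Adj v w then (F v - F w) ^ 2 else 0) := by
      intro v w; split_ifs <;> positivity
    rw [Fintype.sum_sum_type]
    have a1 : P ≤ ∑ i, ∑ w, (if (gr m k σ hm).Adj (.inl i) w then (F (.inl i) - F w) ^ 2 else 0) := by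
      refine Finset.sum_le_sum fun i _ => ?_
      have := Finset.single_le_sum (f := fun w => if (gr m k σ hm).Adj (.inl i) w then (F (.inl i) - F w) ^ 2 else 0)
        (fun w _ => nn _ w) (mem_univ (Sum.inl (i + 1)))
      have adj : (gr m k σ hm).Adj (.inl i) (.inl (i + 1)) := Or.inl rfl
      simpa [adj] using this
    have a2 : Q + X ≤ ∑ i, ∑ w, (if (gr m k σ hm).Adj (.inr i) w then (F (.inr i) - F w) ^ 2 else 0) := by
      rw [← Finset.sum_add_distrib]
      refine Finset.sum_le_sum fun i _ => ?_
      have adj1 : (gr m k σ hm).Adj (.inr i) (.inr (i + 1)) := Or.inl rfl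
      have adj2 : (gr m k σ hm).Adj (.inr i) (.inl (σ i)) := ⟨0, by omega, by simp⟩
      rw [Fintype.sum_sum_type, add_comm]
      refine add_le_add ?_ ?_
      · have := Finset.single_le_sum (f := fun w => if (gr m k σ hm).Adj (.inr i) (.inl w) then (F (.inr i) - F (.inl w)) ^ 2 else 0)
          (fun w _ => nn _ _) (mem_univ (σ i))
        simpa [adj2] using this
      · have := Finset.single_le_sum (f := fun w => if (gr m k σ hm).Adj (.inr i) (.inr w) then (F (.inr i) - F (.inr w)) ^ 2 else 0)
          (fun w _ => nn _ _) (mem_univ (i + 1))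
        simpa [adj1] using this
    linarith
  have e2 : ∑ i, (f (σ i) - f (σ (i + 1))) ^ 2 ≤ 6 * X + 3 * Q := by
    have b : ∑ i, (h (i + 1) - f (σ (i + 1))) ^ 2 = X := hshift (fun i => (h i - f (σ i)) ^ 2)
    calc ∑ i, (f (σ i) - f (σ (i + 1))) ^ 2 ≤ ∑ i, (3 * (h i - f (σ i)) ^ 2 +
          3 * (h (i + 1) - f (σ (i + 1))) ^ 2 + 3 * (h i - h (i + 1)) ^ 2) := by
          refine Finset.sum_le_sum fun i _ => ?_
          nlinarith [sq_nonneg ((h i - f (σ i)) + (h (i + 1) - f (σ (i + 1)))),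
            sq_nonneg ((h i - f (σ i)) + (h i - h (i + 1))),
            sq_nonneg ((h (i + 1) - f (σ (i + 1))) - (h i - h (i + 1)))]
      _ = 6 * X + 3 * Q := by
          rw [Finset.sum_add_distrib, Finset.sum_add_distrib, ← Finset.mul_sum, ← Finset.mul_sum,
            ← Finset.mul_sum, b]; ring
  obtain ⟨c, hc⟩ := hσ f
  refine ⟨c, ?_⟩
  have e3 : ∑ i, (h i - c) ^ 2 ≤ 2 * X + 2 * ∑ i, (f i - c) ^ 2 := by
    rw [← hperm (fun i => (f i - c) ^ 2), Finset.mul_sum, Finset.mul_sum, ← Finset.sum_add_distrib]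
    refine Finset.sum_le_sum fun i _ => ?_
    nlinarith [sq_nonneg ((h i - f (σ i)) - (f (σ i) - c))]
  rw [Fintype.sum_sum_type]
  change ∑ i, (f i - c) ^ 2 + ∑ i, (h i - c) ^ 2 ≤ _
  linarith

theorem exists_regular_graph_with_lambda2_bounded_below (k : ℕ) (hk : 3 ≤ k) :
    ∃ c : ℝ, 0 < c ∧ ∃ N : ℕ, ∀ n : ℕ, N ≤ n → Even (n * k) →
      ∃ G : SimpleGraph (Fin n),
        (∀ v : Fin n, {w | G.Adj v w}.ncard = k) ∧
        c ≤ lambda2 (lap G) := by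
  classical
  refine ⟨1 / (2 * (1 + 6 * 1000000)), by norm_num, 2 * k + 2, fun n hn heven => ?_⟩
  obtain ⟨m, hm⟩ := Nat.even_or_odd' n
  have hkm : k ≤ m := by omega
  have : NeZero m := ⟨by omega⟩
  obtain ⟨σ, hσ⟩ := poincare_two m
  have hm3 : 3 ≤ m := by omega
  have hreg := gr_reg m k σ hm3 (by omega) hkm
  have hPI := gr_PI m k σ hm3 hk hσ
  rcases hm with hm | hm
  · have e : Fin n ≃ ZMod m ⊕ ZMod m := Fintype.equivOfCardEq (by simp [ZMod.card]; omega)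
    obtain ⟨h1, h2⟩ := transfer e _ k _ hreg hPI
    refine ⟨_, h1, le_trans ?_ (lambda2_ge (by omega) _ _ (by norm_num) h2)⟩
    norm_num
  · have hke : Even k := by
      rcases Nat.even_mul.1 heven with h | h
      · exact absurd h (by rw [Nat.not_even_iff_odd]; exact ⟨m, hm⟩)
      · exact h
    obtain ⟨l, hl⟩ := hke
    obtain ⟨J, -, hJ⟩ := Finset.exists_subset_card_eq (s := (univ : Finset (ZMod m))) (n := l)
      (by rw [card_univ, ZMod.card]; omega)
    set τ : ZMod m ⊕ ZMod m ≃ ZMod m ⊕ ZMod m :=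
      { toFun := Sum.elim (fun i => .inr (σ.symm i)) (fun j => .inl (σ j))
        invFun := Sum.elim (fun i => .inr (σ.symm i)) (fun j => .inl (σ j))
        left_inv := by rintro (i | i) <;> simp
        right_inv := by rintro (i | i) <;> simp } with hτdef
    set M : Finset (ZMod m ⊕ ZMod m) := (J.map σ.toEmbedding).disjSum J with hM
    obtain ⟨h1, h2⟩ := surg_good (gr m k σ hm3) M τ (fun v => τ.left_inv v)
      (by rintro (i | i) <;> simp [hM, hτdef, Finset.mem_map_equiv]) k _ (by norm_num)
      (by
        rintro (i | i) hi
        · exact ⟨0, by omega, by simp⟩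
        · exact ⟨0, by omega, by simp⟩)
      (by rw [hM, card_disjSum, card_map]; omega) (by omega) hreg hPI
    have e : Fin n ≃ Option (ZMod m ⊕ ZMod m) := Fintype.equivOfCardEq (by simp [ZMod.card]; omega)
    obtain ⟨h3, h4⟩ := transfer e _ k _ h1 h2
    exact ⟨_, h3, lambda2_ge (by omega) _ _ (by norm_num) h4⟩
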